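/- arXiv:2308.11966 — 3 statements merged into one kernel-verified Lean document; each statement's English description precedes it below -/
import Mathlib

section
/- Let λ, α₁, α₂, α₃, c₁, c₂, c₃, c₄ ∈ ℂ with sin(λ) ≠ 0 and c₁ ≠ 0, and let a, b : ℂ → ℂ be functions with b(w) ≠ 0 for every w ∈ ℂ. Set K := c₁α₁ + c₃α₂ + (c₂ + c₄)α₃ and M := c₂c₄α₁ + c₁²α₂ + c₁(c₂ + c₄)α₃. Then the following are equivalent: (i) for all u, v ∈ ℂ, c₁·(a(u)·b(v)·sin(2u) − a(v)·b(u)·sin(2v)) + b(u)·b(v)·(sin(u − v)/sin(λ))·(c₁·K·sin(u + v) − M·sin(u + v − λ)) = 0; (ii) there exists κ ∈ ℂ such that for all u ∈ ℂ, 2·c₁·a(u)·sin(2u)·sin(λ) = b(u)·(c₁·κ + c₁·K·cos(2u) − M·cos(2u − λ)). -/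
/-- Equivalence between the vanishing of a BYBE diagram coefficient and the explicit
form of the boundary face operator coefficient `a(u)` in the ghost algebra. -/
theorem ghost_BYBE_a_coefficient
    (lam α₁ α₂ α₃ c₁ c₂ c₃ c₄ K M : ℂ)
    (hlam : Complex.sin lam ≠ 0) (hc₁ : c₁ ≠ 0)
    (a b : ℂ → ℂ) (hb : ∀ w : ℂ, b w ≠ 0)
    (hK : K = c₁ * α₁ + c₃ * α₂ + (c₂ + c₄) * α₃)
    (hM : M = c₂ * c₄ * α₁ + c₁ ^ 2 * α₂ + c₁ * (c₂ + c₄) * α₃) :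
    (∀ u v : ℂ,
        c₁ * (a u * b v * Complex.sin (2 * u) - a v * b u * Complex.sin (2 * v)) +
          b u * b v * (Complex.sin (u - v) / Complex.sin lam) *
            (c₁ * K * Complex.sin (u + v) - M * Complex.sin (u + v - lam)) = 0)
    ↔ ∃ κ : ℂ, ∀ u : ℂ,
        2 * c₁ * a u * Complex.sin (2 * u) * Complex.sin lam =
          b u * (c₁ * κ + c₁ * K * Complex.cos (2 * u) - M * Complex.cos (2 * u - lam)) := by
  have key : ∀ u v : ℂ, ∀ l : ℂ, 2 * (Complex.sin (u - v) * Complex.sin (u + v - l)) =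
      Complex.cos (2 * v - l) - Complex.cos (2 * u - l) := by
    intro u v l
    have h1 : 2 * v - l = (u + v - l) - (u - v) := by ring
    have h2 : 2 * u - l = (u + v - l) + (u - v) := by ring
    rw [h1, h2, Complex.cos_sub (u + v - l), Complex.cos_add (u + v - l)]
    ring
  have key0 : ∀ u v : ℂ, 2 * (Complex.sin (u - v) * Complex.sin (u + v)) =
      Complex.cos (2 * v) - Complex.cos (2 * u) := by
    intro u v
    simpa using key u v 0
  have main : ∀ u v : ℂ,
      2 * Complex.sin lam *
        (c₁ * (a u * b v * Complex.sin (2 * u) - a v * b u * Complex.sin (2 * v)) +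
          b u * b v * (Complex.sin (u - v) / Complex.sin lam) *
            (c₁ * K * Complex.sin (u + v) - M * Complex.sin (u + v - lam))) =
      b v * (2 * c₁ * a u * Complex.sin (2 * u) * Complex.sin lam)
        - b u * (2 * c₁ * a v * Complex.sin (2 * v) * Complex.sin lam)
        + b u * b v * (c₁ * K * (Complex.cos (2 * v) - Complex.cos (2 * u))
          - M * (Complex.cos (2 * v - lam) - Complex.cos (2 * u - lam))) := by
    intro u v
    rw [← key, ← key0]
    field_simp
  constructor
  · intro h
    refine ⟨-K + M * Complex.cos lam / c₁, fun u => ?_⟩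
    have h1 := main u 0
    rw [h u 0] at h1
    simp only [mul_zero, Complex.sin_zero, Complex.cos_zero, zero_sub, Complex.cos_neg,
      zero_mul, sub_zero] at h1
    apply mul_left_cancel₀ (hb 0)
    have h2 : c₁ * (-K + M * Complex.cos lam / c₁) = -(c₁ * K) + M * Complex.cos lam := by
      field_simp
    rw [h2]
    linear_combination -h1
  · rintro ⟨κ, h⟩ u v
    have h1 := main u v
    rw [h u, h v] at h1
    have h2 : (2 : ℂ) * Complex.sin lam ≠ 0 := mul_ne_zero two_ne_zero hlam
    apply mul_left_cancel₀ h2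
    rw [h1]
    ring
end

section
/- Let α₁, α₂, α₃, m₁, m₂, m₃, m₄ ∈ ℂ with α₁α₂ − α₃² ≠ 0 and with m₂ and m₃ not both zero. If m₁m₂α₁ + m₃m₄α₂ + (m₁m₃ + m₂m₄)α₃ = 0, then there exists z ∈ ℂ such that m₁·(α₁α₂ − α₃²) = (m₃α₂ + m₂α₃)·z and m₄·(α₁α₂ − α₃²) = −(m₂α₁ + m₃α₃)·z. -/
/-- Final step of Case 2.1.2.1 in the dilute ghost algebra BYBE classification:
solvability of the linear constraint on `m₁` and `m₄`. -/
theorem case21221_linear_solvability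
    (α₁ α₂ α₃ m₁ m₂ m₃ m₄ : ℂ)
    (hA : α₁ * α₂ - α₃ ^ 2 ≠ 0)
    (hm : ¬(m₂ = 0 ∧ m₃ = 0))
    (h : m₁ * m₂ * α₁ + m₃ * m₄ * α₂ + (m₁ * m₃ + m₂ * m₄) * α₃ = 0) :
    ∃ z : ℂ, m₁ * (α₁ * α₂ - α₃ ^ 2) = (m₃ * α₂ + m₂ * α₃) * z ∧
      m₄ * (α₁ * α₂ - α₃ ^ 2) = -(m₂ * α₁ + m₃ * α₃) * z := by
  by_cases h3 : m₃ = 0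
  · have h2 : m₂ ≠ 0 := fun h2 => hm ⟨h2, h3⟩
    refine ⟨-(m₄ * α₂ + m₁ * α₃) / m₂, ?_, ?_⟩
    · rw [← mul_div_assoc, eq_div_iff h2]
      linear_combination α₂ * h
    · rw [← mul_div_assoc, eq_div_iff h2]
      linear_combination -α₃ * h
  · refine ⟨(m₁ * α₁ + m₄ * α₃) / m₃, ?_, ?_⟩
    · rw [← mul_div_assoc, eq_div_iff h3]
      linear_combination -α₃ * h
    · rw [← mul_div_assoc, eq_div_iff h3]
      linear_combination α₁ * h
end

section
/- Let P₁, P₋₃, α₁, α₂, α₃, c₁, c₂, c₃, c₄ ∈ ℂ with P₋₃ ≠ 0, α₃ ≠ 0 and c₁c₃ ≠ c₂c₄, and set K := c₁α₁ + c₃α₂ + (c₂ + c₄)α₃. If c₂·K·P₁ + (c₂c₃α₁ + c₁c₂α₂ + (c₂² + c₁c₃)α₃)·P₋₃ = 0 and c₄·K·P₁ + (c₃c₄α₁ + c₁c₄α₂ + (c₁c₃ + c₄²)α₃)·P₋₃ = 0, then c₂ = c₄. -/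
/-- From the diagram-coefficient constraints (211c7) and (211c9) of the dilute ghost
algebra BYBE classification, deduce `c₂ = c₄`. -/
theorem case2111_second_relation
    (P₁ Pm3 α₁ α₂ α₃ c₁ c₂ c₃ c₄ K : ℂ)
    (hPm3 : Pm3 ≠ 0) (hα₃ : α₃ ≠ 0) (hc : c₁ * c₃ ≠ c₂ * c₄)
    (hK : K = c₁ * α₁ + c₃ * α₂ + (c₂ + c₄) * α₃)
    (h₁ : c₂ * K * P₁ +
      (c₂ * c₃ * α₁ + c₁ * c₂ * α₂ + (c₂ ^ 2 + c₁ * c₃) * α₃) * Pm3 = 0)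
    (h₂ : c₄ * K * P₁ +
      (c₃ * c₄ * α₁ + c₁ * c₄ * α₂ + (c₁ * c₃ + c₄ ^ 2) * α₃) * Pm3 = 0) :
    c₂ = c₄ := by
  have h : (c₂ - c₄) * ((c₁ * c₃ - c₂ * c₄) * (α₃ * Pm3)) = 0 := by
    linear_combination c₂ * h₂ - c₄ * h₁
  rcases mul_eq_zero.mp h with h | h
  · exact sub_eq_zero.mp h
  · exact absurd h (mul_ne_zero (sub_ne_zero.mpr hc) (mul_ne_zero hα₃ hPm3))
end
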